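/- For all integers n and k with 1 ≤ k ≤ n/2, one has i(n,k) ≤ 2ek · E[ |𝓛(X_k)| / max( m(X_k), k - S(X_k) )^2 ], where for a vector c = (c_1,…,c_k) of non-negative integers, S(c) = c_1 + 2c_2 + … + k·c_k and m(c) = max({ i : c_i > 0 } ∪ {1}). -/

import Mathlib

open scoped BigOperators

noncomputable section

/-- The set `𝓛(c) = { m₁ + 2m₂ + ⋯ + k·m_k : 0 ≤ m_j ≤ c_j }`. -/
def Lset (k : ℕ) (c : Fin k → ℕ) : Finset ℕ :=
  (Finset.Icc 0 c).image fun m => ∑ j : Fin k, ((j : ℕ) + 1) * m j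

/-- Probability mass of a Poisson random variable with parameter `lam` at `n`. -/
def poissonPdf (lam : ℝ) (n : ℕ) : ℝ := Real.exp (-lam) * lam ^ n / (Nat.factorial n)

/-- Joint probability mass of the independent vector `X_k = (X_1,…,X_k)`,
`X_i ∼ Pois(1/i)`, at `c`. -/
def pmfVec (k : ℕ) (c : Fin k → ℕ) : ℝ := ∏ i : Fin k, poissonPdf (1 / ((i : ℕ) + 1)) (c i)

/-- `S(c) = c₁ + 2c₂ + ⋯ + k·c_k`. -/
def Sfun (k : ℕ) (c : Fin k → ℕ) : ℕ := ∑ i : Fin k, ((i : ℕ) + 1) * c i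

/-- `m(c) = max({ i : c_i > 0 } ∪ {1})`. -/
def mfun (k : ℕ) (c : Fin k → ℕ) : ℕ :=
  max 1 ((Finset.univ.filter fun i : Fin k => 0 < c i).sup fun i => (i : ℕ) + 1)

/-- `π` has an invariant set of size `k`. -/
def hasInvariantSet (n k : ℕ) (π : Equiv.Perm (Fin n)) : Prop :=
  ∃ s : Finset (Fin n), s.card = k ∧ ∀ x ∈ s, π x ∈ s

/-- `i(n,k)`: the proportion of permutations of `{1,…,n}` having an invariant set of size `k`. -/
def iProp (n k : ℕ) : ℝ :=
  (Nat.card {π : Equiv.Perm (Fin n) // hasInvariantSet n k π} : ℝ) /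
    (Nat.card (Equiv.Perm (Fin n)) : ℝ)

/-- The order of the centralizer of a permutation whose cycle lengths, fixed points included,
form the multiset `M`. -/
def centralizerCard (M : Multiset ℕ) : ℕ := M.prod * ∏ i ∈ M.toFinset, (M.count i).factorial

/-- The proportion of permutations whose cycle lengths, fixed points included, form the
multiset `M`. -/
def cycleWeight (M : Multiset ℕ) : ℝ := (centralizerCard M : ℝ)⁻¹

lemma centralizerCard_eq_of_subset {M : Multiset ℕ} {T : Finset ℕ} (h : M.toFinset ⊆ T) :
    centralizerCard M = M.prod * ∏ i ∈ T, (M.count i).factorial := by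
  rw [centralizerCard, Finset.prod_subset h]
  intro x _ hx
  rw [Multiset.count_eq_zero_of_notMem (by simpa using hx), Nat.factorial_zero]

lemma centralizerCard_zero : centralizerCard 0 = 1 := by simp [centralizerCard]

lemma centralizerCard_cons (i : ℕ) (M : Multiset ℕ) :
    centralizerCard (i ::ₘ M) = centralizerCard M * (i * (M.count i + 1)) := by
  have hi : i ∈ (i ::ₘ M).toFinset := by simp
  rw [centralizerCard, centralizerCard_eq_of_subset (M := M) (T := (i ::ₘ M).toFinset)
    (by simp), ← Finset.mul_prod_erase _ _ hi, ← Finset.mul_prod_erase _ _ hi,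
    Multiset.prod_cons, Multiset.count_cons_self, Nat.factorial_succ]
  have : ∏ x ∈ (i ::ₘ M).toFinset.erase i, ((i ::ₘ M).count x).factorial
      = ∏ x ∈ (i ::ₘ M).toFinset.erase i, (M.count x).factorial := by
    refine Finset.prod_congr rfl fun x hx => ?_
    rw [Multiset.count_cons_of_ne (Finset.ne_of_mem_erase hx)]
  rw [this]
  ring

lemma centralizerCard_pos {M : Multiset ℕ} (h : ∀ i ∈ M, 0 < i) : 0 < centralizerCard M := by
  induction M using Multiset.induction_on with
  | empty => simp [centralizerCard_zero]
  | cons i M ih =>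
    rw [centralizerCard_cons]
    have := ih fun x hx => h x (Multiset.mem_cons_of_mem hx)
    have := h i (Multiset.mem_cons_self i M)
    positivity

lemma centralizerCard_mul_le_add (M N : Multiset ℕ) :
    centralizerCard M * centralizerCard N ≤ centralizerCard (M + N) := by
  induction N using Multiset.induction_on with
  | empty => simp [centralizerCard_zero]
  | cons i N ih =>
    rw [Multiset.add_cons, centralizerCard_cons, centralizerCard_cons, ← mul_assoc]
    gcongr
    simp

lemma centralizerCard_replicate_one_add (r : ℕ) {M : Multiset ℕ} (h : 1 ∉ M) :
    centralizerCard (Multiset.replicate r 1 + M) = centralizerCard M * r.factorial := by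
  induction r with
  | zero => simp
  | succ r ih =>
    rw [Multiset.replicate_succ, Multiset.cons_add, centralizerCard_cons, ih, Multiset.count_add,
      Multiset.count_replicate_self, Multiset.count_eq_zero_of_notMem h, Nat.factorial_succ]
    ring

lemma cycleWeight_nonneg (M : Multiset ℕ) : 0 ≤ cycleWeight M := by
  unfold cycleWeight; positivity

lemma cycleWeight_add_le {M N : Multiset ℕ} (hM : ∀ i ∈ M, 0 < i) (hN : ∀ i ∈ N, 0 < i) :
    cycleWeight (M + N) ≤ cycleWeight M * cycleWeight N := by
  have h1 := centralizerCard_pos hM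
  have h2 := centralizerCard_pos hN
  rw [cycleWeight, cycleWeight, cycleWeight, ← mul_inv]
  apply inv_anti₀ (by positivity)
  exact_mod_cast centralizerCard_mul_le_add M N

lemma cycleWeight_singleton (j : ℕ) : cycleWeight {j} = (j : ℝ)⁻¹ := by
  simp [cycleWeight, centralizerCard]

lemma mul_count_mul_cycleWeight {M : Multiset ℕ} {i : ℕ} (hi : i ∈ M) (hi0 : 0 < i) :
    (M.count i * i : ℕ) * cycleWeight M = cycleWeight (M.erase i) := by
  obtain ⟨N, rfl⟩ := Multiset.exists_cons_of_mem hi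
  rw [Multiset.erase_cons_head, cycleWeight, cycleWeight, centralizerCard_cons,
    Multiset.count_cons_self]
  push_cast
  have : (i : ℝ) ≠ 0 := by positivity
  have : (N.count i + 1 : ℝ) ≠ 0 := by positivity
  rw [mul_inv]
  field_simp

/-- The multisets of positive integers with sum `N` and all elements at least `j`. -/
def roughPartitions (N j : ℕ) : Finset (Multiset ℕ) :=
  ((Finset.univ : Finset (Nat.Partition N)).image Nat.Partition.parts).filter
    fun g => ∀ i ∈ g, j ≤ i

lemma mem_roughPartitions {N j : ℕ} (hj : 1 ≤ j) {g : Multiset ℕ} :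
    g ∈ roughPartitions N j ↔ g.sum = N ∧ ∀ i ∈ g, j ≤ i := by
  simp only [roughPartitions, Finset.mem_filter, Finset.mem_image, Finset.mem_univ, true_and]
  constructor
  · rintro ⟨⟨p, rfl⟩, h⟩
    exact ⟨p.parts_sum, h⟩
  · rintro ⟨h, h'⟩
    exact ⟨⟨⟨g, fun {i} hi => hj.trans (h' i hi), h⟩, rfl⟩, h'⟩

lemma natCast_mul_sum_cycleWeight_le {N j : ℕ} (hj : 1 ≤ j) :
    (N : ℝ) * ∑ g ∈ roughPartitions N j, cycleWeight g ≤
      ∑ i ∈ Finset.Icc j N, ∑ g ∈ roughPartitions (N - i) j, cycleWeight g := by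
  have h1 : (N : ℝ) * ∑ g ∈ roughPartitions N j, cycleWeight g =
      ∑ g ∈ roughPartitions N j, ∑ i ∈ g.toFinset, cycleWeight (g.erase i) := by
    rw [Finset.mul_sum]
    refine Finset.sum_congr rfl fun g hg => ?_
    rw [mem_roughPartitions hj] at hg
    rw [← hg.1, Finset.sum_multiset_count, Nat.cast_sum, Finset.sum_mul]
    refine Finset.sum_congr rfl fun i hi => ?_
    rw [Multiset.mem_toFinset] at hi
    rw [smul_eq_mul, mul_count_mul_cycleWeight hi (hj.trans (hg.2 i hi))]
  rw [h1, Finset.sum_sigma', Finset.sum_sigma']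
  let f : (Σ _ : Multiset ℕ, ℕ) → (Σ _ : ℕ, Multiset ℕ) := fun x => ⟨x.2, x.1.erase x.2⟩
  have hinj : Set.InjOn f ((roughPartitions N j).sigma fun g => g.toFinset) := by
    rintro ⟨g, i⟩ h ⟨g', i'⟩ h' heq
    simp only [Finset.coe_sigma, Set.mem_sigma_iff, Finset.mem_coe, Multiset.mem_toFinset] at h h'
    simp only [f, Sigma.mk.injEq, heq_eq_eq] at heq
    obtain ⟨rfl, he⟩ := heq
    rw [← Multiset.cons_erase h.2, he, Multiset.cons_erase h'.2]
  calc _ = ∑ x ∈ ((roughPartitions N j).sigma fun g => g.toFinset).image f, cycleWeight x.2 := by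
        rw [Finset.sum_image hinj]
    _ ≤ _ := by
        refine Finset.sum_le_sum_of_subset_of_nonneg ?_ fun _ _ _ => cycleWeight_nonneg _
        intro y hy
        simp only [Finset.mem_image, Finset.mem_sigma, Multiset.mem_toFinset,
          mem_roughPartitions hj] at hy
        obtain ⟨⟨g, i⟩, ⟨⟨hs, hg⟩, hi⟩, rfl⟩ := hy
        dsimp only at hs hg hi
        obtain ⟨g, rfl⟩ := Multiset.exists_cons_of_mem hi
        have := hg i hi
        rw [Multiset.sum_cons] at hs
        simp only [f, Finset.mem_sigma, Finset.mem_Icc, mem_roughPartitions hj,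
          Multiset.erase_cons_head]
        exact ⟨⟨by omega, by omega⟩, by omega, fun x hx => hg x (Multiset.mem_cons_of_mem hx)⟩

lemma sum_cycleWeight_roughPartitions_zero_le {j : ℕ} (hj : 1 ≤ j) :
    ∑ g ∈ roughPartitions 0 j, cycleWeight g ≤ 1 := by
  have : roughPartitions 0 j ⊆ {0} := by
    intro g hg
    rw [mem_roughPartitions hj] at hg
    rw [Finset.mem_singleton]
    by_contra h0
    obtain ⟨i, hi⟩ := Multiset.exists_mem_of_ne_zero h0
    have := Multiset.le_sum_of_mem hi
    have := hg.2 i hi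
    omega
  refine (Finset.sum_le_sum_of_subset_of_nonneg this fun _ _ _ => cycleWeight_nonneg _).trans ?_
  simp [cycleWeight, centralizerCard_zero]

/-- At most a proportion `1 / j` of the permutations of a nonempty set have all their cycles of
length at least `j`. -/
lemma sum_cycleWeight_roughPartitions_le {j : ℕ} (hj : 1 ≤ j) {N : ℕ} (hN : 1 ≤ N) :
    ∑ g ∈ roughPartitions N j, cycleWeight g ≤ (j : ℝ)⁻¹ := by
  induction N using Nat.strong_induction_on with
  | _ N ih =>
    have hN0 : (0 : ℝ) < N := by exact_mod_cast hN
    have hj0 : (0 : ℝ) < j := by exact_mod_cast hj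
    refine le_of_mul_le_mul_left ((natCast_mul_sum_cycleWeight_le hj).trans ?_) hN0
    rcases lt_or_ge N j with h | h
    · rw [Finset.Icc_eq_empty (by omega), Finset.sum_empty]
      positivity
    · rw [← Finset.Ico_insert_right h, Finset.sum_insert (by simp), Nat.sub_self]
      have h1 : ∑ i ∈ Finset.Ico j N, ∑ g ∈ roughPartitions (N - i) j, cycleWeight g
          ≤ ∑ i ∈ Finset.Ico j N, (j : ℝ)⁻¹ := by
        refine Finset.sum_le_sum fun i hi => ?_
        rw [Finset.mem_Ico] at hi
        exact ih (N - i) (by omega) (by omega)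
      rw [Finset.sum_const, Nat.card_Ico, nsmul_eq_mul, Nat.cast_sub h, sub_mul,
        mul_inv_cancel₀ hj0.ne'] at h1
      have := sum_cycleWeight_roughPartitions_zero_le hj
      linarith

lemma exists_le_parts_partition_sum_eq {α : Type*} [Fintype α] [DecidableEq α]
    (π : Equiv.Perm α) (s : Finset α) (hs : ∀ x ∈ s, π x ∈ s) :
    ∃ I ≤ π.partition.parts, I.sum = s.card := by
  have himg : s.image π = s :=
    Finset.eq_of_subset_of_card_le (by simpa [Finset.image_subset_iff] using hs)
      (by rw [Finset.card_image_of_injective _ π.injective])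
  have hiff : ∀ x, π x ∈ s ↔ x ∈ s := by
    refine fun x => ⟨fun h => ?_, hs x⟩
    rw [← himg, Finset.mem_image] at h
    obtain ⟨y, hy, hxy⟩ := h
    rwa [← π.injective hxy]
  set σ : Equiv.Perm α := Equiv.Perm.ofSubtype (π.subtypePerm hiff) with hσ
  have hσmem : ∀ x ∈ s, σ x = π x := fun x hx =>
    Equiv.Perm.ofSubtype_subtypePerm_of_mem hiff hx
  have hσnot : ∀ x ∉ s, σ x = x := fun x hx =>
    Equiv.Perm.ofSubtype_subtypePerm_of_not_mem hiff hx
  set τ : Equiv.Perm α := σ⁻¹ * π with hτ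
  have hτmem : ∀ x ∈ s, τ x = x := fun x hx => by
    rw [hτ, Equiv.Perm.mul_apply, Equiv.Perm.inv_eq_iff_eq, hσmem x hx]
  have hdisj : Equiv.Perm.Disjoint σ τ := fun x => by
    by_cases hx : x ∈ s
    · exact Or.inr (hτmem x hx)
    · exact Or.inl (hσnot x hx)
  have hmul : σ * τ = π := by rw [hτ, mul_inv_cancel_left]
  have hσs : σ.support ⊆ s := fun x hx => by
    by_contra h
    exact Equiv.Perm.mem_support.1 hx (hσnot x h)
  have hτs : τ.support ⊆ sᶜ := fun x hx => by
    rw [Finset.mem_compl]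
    exact fun h => Equiv.Perm.mem_support.1 hx (hτmem x h)
  have h1 := Finset.card_le_card hσs
  have h2 := Finset.card_le_card hτs
  have h3 := hdisj.card_support_mul
  have h4 := hdisj.cycleType_mul
  rw [Finset.card_compl] at h2
  have h5 := s.card_le_univ
  rw [hmul] at h3 h4
  refine ⟨σ.cycleType + Multiset.replicate (s.card - σ.support.card) 1, ?_, ?_⟩
  · rw [Equiv.Perm.parts_partition, h4]
    exact add_le_add (Multiset.le_add_right _ _)
      ((Multiset.replicate_le_replicate 1).2 (by omega))
  · rw [Multiset.sum_add, Equiv.Perm.sum_cycleType, Multiset.sum_replicate]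
    simp only [smul_eq_mul, mul_one]
    omega

lemma card_parts_partition_eq_le {α : Type*} [Fintype α] [DecidableEq α] (d : Multiset ℕ) :
    ((Finset.univ.filter fun π : Equiv.Perm α => π.partition.parts = d).card : ℝ) ≤
      (Fintype.card α).factorial * cycleWeight d := by
  rcases (Finset.univ.filter fun π : Equiv.Perm α => π.partition.parts = d).eq_empty_or_nonempty
    with h | ⟨σ, hσ⟩
  · rw [h, Finset.card_empty, Nat.cast_zero]
    exact mul_nonneg (by positivity) (cycleWeight_nonneg d)
  · have hd : σ.partition.parts = d := by simpa using hσ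
    have hsub : (Finset.univ.filter fun π : Equiv.Perm α => π.partition.parts = d) ⊆
        Finset.univ.filter fun π : Equiv.Perm α => π.cycleType = σ.cycleType := by
      intro π hπ
      simp only [Finset.mem_filter, Finset.mem_univ, true_and] at hπ ⊢
      rw [← Equiv.Perm.filter_parts_partition_eq_cycleType,
        ← Equiv.Perm.filter_parts_partition_eq_cycleType, hπ, hd]
    have hcard := Equiv.Perm.card_of_cycleType_mul_eq (α := α) σ.cycleType
    rw [if_pos ⟨σ.sum_cycleType_le, fun a => Equiv.Perm.two_le_of_mem_cycleType⟩] at hcard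
    have h1 : 1 ∉ σ.cycleType := fun h => by
      have := Equiv.Perm.two_le_of_mem_cycleType h
      omega
    have hz : centralizerCard d = (Fintype.card α - σ.cycleType.sum).factorial *
        σ.cycleType.prod * ∏ n ∈ σ.cycleType.toFinset, (σ.cycleType.count n).factorial := by
      rw [← hd, Equiv.Perm.parts_partition, add_comm, centralizerCard_replicate_one_add _ h1,
        Equiv.Perm.sum_cycleType, centralizerCard]
      ring
    rw [← hz] at hcard
    have hpos : 0 < centralizerCard d :=
      centralizerCard_pos fun i hi => σ.partition.parts_pos (hd ▸ hi)
    rw [cycleWeight, ← div_eq_mul_inv, le_div_iff₀ (by exact_mod_cast hpos)]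
    rw [← hcard]
    push_cast
    gcongr

open Classical in
lemma iProp_le_sum_cycleWeight (n k : ℕ) :
    iProp n k ≤ ∑ d ∈ (roughPartitions n 1).filter (fun d => ∃ I ≤ d, I.sum = k),
      cycleWeight d := by
  set G := (roughPartitions n 1).filter (fun d => ∃ I ≤ d, I.sum = k) with hG
  have hmaps : ∀ π ∈ Finset.univ.filter (hasInvariantSet n k), π.partition.parts ∈ G := by
    intro π hπ
    obtain ⟨s, hs, hinv⟩ := (Finset.mem_filter.1 hπ).2
    rw [hG, Finset.mem_filter, mem_roughPartitions le_rfl]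
    refine ⟨⟨π.partition.parts_sum.trans (Fintype.card_fin n),
      fun i hi => π.partition.parts_pos hi⟩, ?_⟩
    rw [← hs]
    exact exists_le_parts_partition_sum_eq π s hinv
  have hcard := Finset.card_eq_sum_card_fiberwise hmaps
  have hn : (0 : ℝ) < n.factorial := by exact_mod_cast n.factorial_pos
  rw [iProp, Nat.card_eq_fintype_card, Nat.card_eq_fintype_card, Fintype.card_perm,
    Fintype.card_fin, div_le_iff₀ hn, Fintype.card_subtype, hcard, Nat.cast_sum, Finset.sum_mul]
  refine Finset.sum_le_sum fun d _ => ?_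
  rw [mul_comm]
  refine le_trans ?_ ((card_parts_partition_eq_le (α := Fin n) d).trans_eq
    (by rw [Fintype.card_fin]))
  gcongr
  exact Finset.subset_univ _

/-- The multiset containing `i + 1` with multiplicity `v i`. -/
def vecMultiset (k : ℕ) (v : Fin k → ℕ) : Multiset ℕ :=
  ∑ i : Fin k, Multiset.replicate (v i) ((i : ℕ) + 1)

lemma mem_vecMultiset {k : ℕ} {v : Fin k → ℕ} {x : ℕ} :
    x ∈ vecMultiset k v ↔ ∃ i : Fin k, 0 < v i ∧ x = (i : ℕ) + 1 := by
  simp [vecMultiset, Multiset.mem_sum, Multiset.mem_replicate, Nat.pos_iff_ne_zero]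

lemma count_vecMultiset (k : ℕ) (v : Fin k → ℕ) (i : Fin k) :
    (vecMultiset k v).count ((i : ℕ) + 1) = v i := by
  simp [vecMultiset, Multiset.count_sum', Multiset.count_replicate, Fin.val_inj]

lemma sum_vecMultiset (k : ℕ) (v : Fin k → ℕ) : (vecMultiset k v).sum = Sfun k v := by
  simp [vecMultiset, Sfun, Multiset.sum_sum, mul_comm]

lemma vecMultiset_count {k : ℕ} {c : Multiset ℕ} (h : ∀ i ∈ c, 0 < i ∧ i ≤ k) :
    vecMultiset k (fun i => c.count ((i : ℕ) + 1)) = c := by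
  ext x
  by_cases hx : 0 < x ∧ x ≤ k
  · have := count_vecMultiset k (fun i => c.count ((i : ℕ) + 1)) ⟨x - 1, by omega⟩
    simpa [Nat.sub_add_cancel hx.1] using this
  · rw [Multiset.count_eq_zero_of_notMem fun hc => hx (h x hc), Multiset.count_eq_zero]
    rw [mem_vecMultiset]
    rintro ⟨i, -, rfl⟩
    exact hx ⟨by omega, i.2⟩

lemma sum_mem_Lset {k : ℕ} {v : Fin k → ℕ} {I : Multiset ℕ} (h : I ≤ vecMultiset k v) :
    I.sum ∈ Lset k v := by
  have hI : ∀ i ∈ I, 0 < i ∧ i ≤ k := fun i hi => by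
    obtain ⟨a, -, rfl⟩ := mem_vecMultiset.1 (Multiset.mem_of_le h hi)
    exact ⟨by omega, a.2⟩
  rw [Lset, Finset.mem_image]
  refine ⟨fun i => I.count ((i : ℕ) + 1), ?_, ?_⟩
  · rw [Finset.mem_Icc]
    refine ⟨fun _ => Nat.zero_le _, fun i => ?_⟩
    rw [← count_vecMultiset k v i]
    exact Multiset.count_le_of_le _ h
  · conv_rhs => rw [← vecMultiset_count hI, sum_vecMultiset]
    rfl

lemma mfun_le {k j : ℕ} {v : Fin k → ℕ} (hj : 1 ≤ j) (h : ∀ i ∈ vecMultiset k v, i ≤ j) :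
    mfun k v ≤ j := by
  refine max_le hj (Finset.sup_le fun i hi => h _ (mem_vecMultiset.2 ⟨i, ?_, rfl⟩))
  simpa using hi

lemma centralizerCard_vecMultiset (k : ℕ) (v : Fin k → ℕ) :
    centralizerCard (vecMultiset k v) = ∏ i : Fin k, ((i : ℕ) + 1) ^ v i * (v i).factorial := by
  have hsub : (vecMultiset k v).toFinset ⊆ Finset.univ.image fun i : Fin k => (i : ℕ) + 1 := by
    intro x hx
    rw [Multiset.mem_toFinset, mem_vecMultiset] at hx
    obtain ⟨i, -, rfl⟩ := hx
    exact Finset.mem_image_of_mem _ (Finset.mem_univ i)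
  rw [centralizerCard_eq_of_subset hsub, Finset.prod_image (fun i _ j _ h => by
    simpa [Fin.val_inj] using h), Finset.prod_mul_distrib]
  congr 1
  · simp [vecMultiset, Multiset.prod_sum]
  · simp only [count_vecMultiset]

lemma pmfVec_eq (k : ℕ) (v : Fin k → ℕ) :
    pmfVec k v = Real.exp (-(harmonic k : ℝ)) * cycleWeight (vecMultiset k v) := by
  have hH : -(harmonic k : ℝ) = ∑ i : Fin k, -(1 / ((i : ℕ) + 1 : ℝ)) := by
    rw [harmonic, Finset.sum_neg_distrib, Finset.sum_range]
    simp
  rw [cycleWeight, centralizerCard_vecMultiset, hH, Real.exp_sum, Nat.cast_prod,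
    ← Finset.prod_inv_distrib, ← Finset.prod_mul_distrib, pmfVec]
  refine Finset.prod_congr rfl fun i _ => ?_
  rw [poissonPdf]
  push_cast
  field_simp
  rw [one_div, inv_pow]
  exact inv_mul_cancel₀ (by positivity)

lemma cycleWeight_vecMultiset_le {k : ℕ} (hk : 1 ≤ k) (v : Fin k → ℕ) :
    cycleWeight (vecMultiset k v) ≤ Real.exp 1 * k * pmfVec k v := by
  have hk0 : (0 : ℝ) < k := by exact_mod_cast hk
  have h : Real.exp (harmonic k) ≤ Real.exp 1 * k := by
    conv_rhs => rw [← Real.exp_log hk0, ← Real.exp_add]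
    exact Real.exp_le_exp.2 (harmonic_le_one_add_log k)
  rw [pmfVec_eq, ← mul_assoc, Real.exp_neg]
  refine le_mul_of_one_le_left (cycleWeight_nonneg _) ?_
  rwa [← div_eq_mul_inv, one_le_div (Real.exp_pos _)]

lemma card_Lset_le (k : ℕ) (v : Fin k → ℕ) : (Lset k v).card ≤ ∏ i : Fin k, (v i + 1) := by
  refine Finset.card_image_le.trans_eq ?_
  simp [Pi.card_Icc]

lemma poissonPdf_nonneg {lam : ℝ} (h : 0 ≤ lam) (n : ℕ) : 0 ≤ poissonPdf lam n := by
  unfold poissonPdf; positivity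

lemma pmfVec_nonneg (k : ℕ) (v : Fin k → ℕ) : 0 ≤ pmfVec k v :=
  Finset.prod_nonneg fun _ _ => poissonPdf_nonneg (by positivity) _

lemma summable_succ_mul_poissonPdf (lam : ℝ) :
    Summable fun a : ℕ => ((a : ℝ) + 1) * poissonPdf lam a := by
  have h0 := Real.summable_pow_div_factorial lam
  have h1 : Summable fun a : ℕ => (a : ℝ) * (lam ^ a / a.factorial) := by
    rw [← summable_nat_add_iff 1]
    refine (h0.mul_left lam).congr fun a => ?_
    rw [Nat.factorial_succ]
    push_cast
    field_simp
    ring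
  refine ((h1.add h0).mul_left (Real.exp (-lam))).congr fun a => ?_
  rw [poissonPdf]
  ring

lemma summable_pi_prod_of_nonneg {ι β : Type*} [Fintype ι] {f : ι → β → ℝ}
    (hf : ∀ i b, 0 ≤ f i b) (hs : ∀ i, Summable (f i)) :
    Summable fun v : ι → β => ∏ i, f i (v i) := by
  classical
  refine summable_of_sum_le (c := ∏ i, ∑' b, f i b)
    (fun v => Finset.prod_nonneg fun i _ => hf i (v i)) fun u => ?_
  calc ∑ v ∈ u, ∏ i, f i (v i)
      ≤ ∑ v ∈ Fintype.piFinset fun i => u.image fun v => v i, ∏ i, f i (v i) := by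
        refine Finset.sum_le_sum_of_subset_of_nonneg (fun v hv => ?_)
          fun v _ _ => Finset.prod_nonneg fun i _ => hf i (v i)
        rw [Fintype.mem_piFinset]
        exact fun i => Finset.mem_image_of_mem (fun v => v i) hv
    _ = ∏ i, ∑ b ∈ u.image fun v => v i, f i b := (Finset.prod_univ_sum _ _).symm
    _ ≤ ∏ i, ∑' b, f i b := Finset.prod_le_prod
        (fun i _ => Finset.sum_nonneg fun b _ => hf i b)
        fun i _ => (hs i).sum_le_tsum _ fun b _ => hf i b

lemma one_le_max_mfun (k : ℕ) (v : Fin k → ℕ) : 1 ≤ max (mfun k v) (k - Sfun k v) :=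
  le_max_of_le_left (le_max_left _ _)

lemma summable_card_Lset_div_mul_pmfVec (k : ℕ) :
    Summable fun v : Fin k → ℕ =>
      ((Lset k v).card : ℝ) / ((max (mfun k v) (k - Sfun k v) : ℕ) : ℝ) ^ 2 * pmfVec k v := by
  refine Summable.of_nonneg_of_le
    (fun v => mul_nonneg (by positivity) (pmfVec_nonneg k v)) (fun v => ?_)
    (summable_pi_prod_of_nonneg
      (f := fun (i : Fin k) (a : ℕ) => ((a : ℝ) + 1) * poissonPdf (1 / ((i : ℕ) + 1)) a)
      (fun i a => mul_nonneg (by positivity) (poissonPdf_nonneg (by positivity) a))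
      fun i => summable_succ_mul_poissonPdf _)
  rw [Finset.prod_mul_distrib, ← pmfVec]
  refine mul_le_mul_of_nonneg_right ?_ (pmfVec_nonneg k v)
  have h1 : (1 : ℝ) ≤ ((max (mfun k v) (k - Sfun k v) : ℕ) : ℝ) := by
    exact_mod_cast one_le_max_mfun k v
  refine (div_le_self (by positivity) (one_le_pow₀ h1)).trans ?_
  exact_mod_cast card_Lset_le k v

lemma exists_add_eq_of_forall_le {A B : Multiset ℕ} {a b : ℕ} (ha : a ∈ A)
    (hA : ∀ i ∈ A, i ≤ a) (hb : b ∈ B) (hab : a ≤ b) :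
    ∃ c g : Multiset ℕ, A + B = c + {a} + g ∧ (∀ i ∈ c, i ≤ a) ∧ g ≠ 0 ∧ (∀ i ∈ g, a ≤ i) ∧
      ∃ I ≤ c, I.sum + a = A.sum := by
  obtain ⟨A, rfl⟩ := Multiset.exists_cons_of_mem ha
  refine ⟨A + B.filter fun i => ¬ a ≤ i, B.filter fun i => a ≤ i, ?_, ?_, ?_, ?_, A,
    Multiset.le_add_right _ _, ?_⟩
  · conv_lhs => rw [← Multiset.filter_add_not (fun i => a ≤ i) B, ← Multiset.singleton_add]
    abel
  · intro i hi
    rcases Multiset.mem_add.1 hi with h | h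
    · exact hA i (Multiset.mem_cons_of_mem h)
    · exact (not_le.1 (Multiset.mem_filter.1 h).2).le
  · intro h
    have : b ∈ B.filter fun i => a ≤ i := Multiset.mem_filter.2 ⟨hb, hab⟩
    rw [h] at this
    exact Multiset.notMem_zero b this
  · exact fun i hi => (Multiset.mem_filter.1 hi).2
  · rw [Multiset.sum_cons, add_comm]

lemma exists_mem_forall_le {A : Multiset ℕ} (h : 1 ≤ A.sum) : ∃ a ∈ A, ∀ i ∈ A, i ≤ a := by
  have hne : A.toFinset.Nonempty := by
    rw [Multiset.toFinset_nonempty]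
    rintro rfl
    simp at h
  refine ⟨A.toFinset.max' hne, Multiset.mem_toFinset.1 (Finset.max'_mem _ _), fun i hi => ?_⟩
  exact Finset.le_max' _ _ (Multiset.mem_toFinset.2 hi)

lemma exists_eq_add_singleton_add {n k : ℕ} (hk : 1 ≤ k) (hkn : 2 * k ≤ n) {d I : Multiset ℕ}
    (hd : d.sum = n) (hI : I ≤ d) (hIk : I.sum = k) :
    ∃ (c : Multiset ℕ) (j : ℕ) (g : Multiset ℕ), d = c + {j} + g ∧ j ≤ k ∧ (∀ i ∈ c, i ≤ j) ∧
      g ≠ 0 ∧ (∀ i ∈ g, j ≤ i) ∧ ∃ I' ≤ c, I'.sum + j = k ∨ I'.sum + j = n - k := by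
  obtain ⟨J, rfl⟩ := Multiset.le_iff_exists_add.1 hI
  rw [Multiset.sum_add] at hd
  obtain ⟨a, ha, hA⟩ := exists_mem_forall_le (A := I) (by omega)
  obtain ⟨b, hb, hB⟩ := exists_mem_forall_le (A := J) (by omega)
  have hak := Multiset.le_sum_of_mem ha
  rcases le_total a b with hab | hab
  · obtain ⟨c, g, h1, h2, h3, h4, I', h5, h6⟩ := exists_add_eq_of_forall_le ha hA hb hab
    exact ⟨c, a, g, h1, by omega, h2, h3, h4, I', h5, by omega⟩
  · obtain ⟨c, g, h1, h2, h3, h4, I', h5, h6⟩ := exists_add_eq_of_forall_le hb hB ha hab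
    exact ⟨c, b, g, (add_comm I J).trans h1, by omega, h2, h3, h4, I', h5, by omega⟩

open Classical in
/-- The lengths that a longest cycle of the smaller of two invariant sets, of sizes `k` and
`n - k`, can have when the remaining cycles that are not longer are counted by `v`. -/
def pivotLengths (n k : ℕ) (v : Fin k → ℕ) : Finset ℕ :=
  (Finset.Icc 1 k).filter fun j => max (mfun k v) (k - Sfun k v) ≤ j ∧ Sfun k v + j < n ∧
    ∃ l ∈ Lset k v, l + j = k ∨ l + j = n - k

lemma card_pivotLengths_le (n k : ℕ) (v : Fin k → ℕ) :
    (pivotLengths n k v).card ≤ 2 * (Lset k v).card := by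
  have hsub : pivotLengths n k v ⊆
      (Lset k v).image (fun l => k - l) ∪ (Lset k v).image fun l => n - k - l := by
    intro j hj
    obtain ⟨-, -, -, l, hl, h | h⟩ := Finset.mem_filter.1 hj
    · exact Finset.mem_union_left _ (Finset.mem_image.2 ⟨l, hl, by omega⟩)
    · exact Finset.mem_union_right _ (Finset.mem_image.2 ⟨l, hl, by omega⟩)
  calc _ ≤ _ := Finset.card_le_card hsub
    _ ≤ _ := Finset.card_union_le _ _
    _ ≤ (Lset k v).card + (Lset k v).card := add_le_add Finset.card_image_le Finset.card_image_le
    _ = _ := by ring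

/-- A finite set of vectors that contains the multiplicity vectors of partitions of `n`. -/
def boundedVecs (n k : ℕ) : Finset (Fin k → ℕ) :=
  Fintype.piFinset fun _ => Finset.range (n + 1)

open Classical in
lemma sum_cycleWeight_le_sum_sigma {n k : ℕ} (hk : 1 ≤ k) (hkn : 2 * k ≤ n) :
    ∑ d ∈ (roughPartitions n 1).filter (fun d => ∃ I ≤ d, I.sum = k), cycleWeight d ≤
      ∑ v ∈ boundedVecs n k, ∑ j ∈ pivotLengths n k v,
        ∑ g ∈ roughPartitions (n - (Sfun k v + j)) j,
          cycleWeight (vecMultiset k v) * (j : ℝ)⁻¹ * cycleWeight g := by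
  set D := (roughPartitions n 1).filter (fun d => ∃ I ≤ d, I.sum = k) with hD
  set T : Finset (Σ _ : Fin k → ℕ, Σ _ : ℕ, Multiset ℕ) :=
    (boundedVecs n k).sigma fun v =>
      (pivotLengths n k v).sigma fun j => roughPartitions (n - (Sfun k v + j)) j with hT
  let F : (Σ _ : Fin k → ℕ, Σ _ : ℕ, Multiset ℕ) → Multiset ℕ :=
    fun x => vecMultiset k x.1 + {x.2.1} + x.2.2
  let W : (Σ _ : Fin k → ℕ, Σ _ : ℕ, Multiset ℕ) → ℝ :=
    fun x => cycleWeight (vecMultiset k x.1) * (x.2.1 : ℝ)⁻¹ * cycleWeight x.2.2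
  have hex : ∀ d ∈ D, ∃ x ∈ T, F x = d := by
    intro d hd
    rw [hD, Finset.mem_filter, mem_roughPartitions le_rfl] at hd
    obtain ⟨⟨hdn, hd1⟩, I, hI, hIk⟩ := hd
    obtain ⟨c, j, g, rfl, hjk, hc, hg0, hg, I', hI', hs⟩ :=
      exists_eq_add_singleton_add hk hkn hdn hI hIk
    have hj : 1 ≤ j := hd1 j (by simp)
    have hck : ∀ i ∈ c, 0 < i ∧ i ≤ k := fun i hi => ⟨hd1 i (by simp [hi]), (hc i hi).trans hjk⟩
    have hvc := vecMultiset_count hck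
    set v : Fin k → ℕ := fun i => c.count ((i : ℕ) + 1) with hv
    have hS : Sfun k v = c.sum := by rw [← sum_vecMultiset, hvc]
    simp only [Multiset.sum_add, Multiset.sum_singleton] at hdn
    obtain ⟨b, hb⟩ := Multiset.exists_mem_of_ne_zero hg0
    have hbg := Multiset.le_sum_of_mem hb
    have hbj := hg b hb
    have hI'L : I'.sum ∈ Lset k v := sum_mem_Lset (hvc.symm ▸ hI')
    have hI'S : I'.sum ≤ c.sum := by
      obtain ⟨K, rfl⟩ := Multiset.le_iff_exists_add.1 hI'
      simp
    have hm : mfun k v ≤ j := mfun_le hj (hvc.symm ▸ hc)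
    refine ⟨⟨v, j, g⟩, ?_, by simp only [F, hvc]⟩
    rw [hT, Finset.mem_sigma, Finset.mem_sigma, mem_roughPartitions hj]
    refine ⟨?_, ?_, ?_, hg⟩
    · refine Fintype.mem_piFinset.2 fun i => ?_
      rw [Finset.mem_range, Nat.lt_succ_iff]
      calc v i ≤ ((i : ℕ) + 1) * v i := Nat.le_mul_of_pos_left _ (by omega)
        _ ≤ Sfun k v := Finset.single_le_sum (f := fun i : Fin k => ((i : ℕ) + 1) * v i)
            (fun _ _ => Nat.zero_le _) (Finset.mem_univ i)
        _ ≤ n := by omega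
    · refine Finset.mem_filter.2 ⟨Finset.mem_Icc.2 ⟨hj, hjk⟩, max_le hm ?_, ?_, I'.sum, hI'L, hs⟩
      · dsimp only
        omega
      · dsimp only
        omega
    · dsimp only
      omega
  choose! f hfT hfF using hex
  have hinj : Set.InjOn f D := fun d hd d' hd' h => by rw [← hfF d hd, ← hfF d' hd', h]
  have hpos : ∀ x, 0 ≤ W x := fun x =>
    mul_nonneg (mul_nonneg (cycleWeight_nonneg _) (by positivity)) (cycleWeight_nonneg _)
  calc ∑ d ∈ D, cycleWeight d ≤ ∑ d ∈ D, W (f d) := by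
        refine Finset.sum_le_sum fun d hd => ?_
        have h0 : ∀ i ∈ F (f d), 0 < i := by
          rw [hfF d hd]
          exact ((mem_roughPartitions le_rfl).1 (Finset.mem_filter.1 hd).1).2
        conv_lhs => rw [← hfF d hd]
        simp only [F, Multiset.mem_add] at h0
        have h1 := cycleWeight_add_le (M := vecMultiset k (f d).1 + {(f d).2.1})
          (N := (f d).2.2) (fun i hi => h0 i (Or.inl (Multiset.mem_add.1 hi)))
          fun i hi => h0 i (Or.inr hi)
        have h2 := cycleWeight_add_le (M := vecMultiset k (f d).1) (N := {(f d).2.1})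
          (fun i hi => h0 i (Or.inl (Or.inl hi))) fun i hi => h0 i (Or.inl (Or.inr hi))
        rw [cycleWeight_singleton] at h2
        exact h1.trans (mul_le_mul_of_nonneg_right h2 (cycleWeight_nonneg _))
    _ = ∑ x ∈ D.image f, W x := (Finset.sum_image hinj).symm
    _ ≤ ∑ x ∈ T, W x := Finset.sum_le_sum_of_subset_of_nonneg
        (Finset.image_subset_iff.2 hfT) fun x _ _ => hpos x
    _ = _ := by rw [hT, Finset.sum_sigma]; simp only [Finset.sum_sigma, W]

lemma sum_pivotLengths_le {n k : ℕ} (v : Fin k → ℕ) :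
    ∑ j ∈ pivotLengths n k v, ∑ g ∈ roughPartitions (n - (Sfun k v + j)) j,
        cycleWeight (vecMultiset k v) * (j : ℝ)⁻¹ * cycleWeight g ≤
      2 * (((Lset k v).card : ℝ) / ((max (mfun k v) (k - Sfun k v) : ℕ) : ℝ) ^ 2) *
        cycleWeight (vecMultiset k v) := by
  set M := max (mfun k v) (k - Sfun k v)
  have hM : (1 : ℝ) ≤ M := by exact_mod_cast one_le_max_mfun k v
  have hterm : ∀ j ∈ pivotLengths n k v, ∑ g ∈ roughPartitions (n - (Sfun k v + j)) j,
      cycleWeight (vecMultiset k v) * (j : ℝ)⁻¹ * cycleWeight g ≤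
      cycleWeight (vecMultiset k v) * ((M : ℝ) ^ 2)⁻¹ := by
    intro j hj
    obtain ⟨hj1, hMj, hlt, -⟩ := Finset.mem_filter.1 hj
    have hMj' : (M : ℝ) ≤ j := by exact_mod_cast hMj
    rw [← Finset.mul_sum, mul_assoc]
    refine mul_le_mul_of_nonneg_left ?_ (cycleWeight_nonneg _)
    have h := sum_cycleWeight_roughPartitions_le (Finset.mem_Icc.1 hj1).1
      (N := n - (Sfun k v + j)) (by omega)
    calc _ ≤ (j : ℝ)⁻¹ * (j : ℝ)⁻¹ := by gcongr
      _ ≤ (M : ℝ)⁻¹ * (M : ℝ)⁻¹ := by gcongr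
      _ = _ := by rw [← mul_inv, sq]
  have hcard : ((pivotLengths n k v).card : ℝ) ≤ 2 * (Lset k v).card := by
    exact_mod_cast card_pivotLengths_le n k v
  refine (Finset.sum_le_card_nsmul _ _ _ hterm).trans ?_
  rw [nsmul_eq_mul]
  have h0 : 0 ≤ cycleWeight (vecMultiset k v) * ((M : ℝ) ^ 2)⁻¹ :=
    mul_nonneg (cycleWeight_nonneg _) (by positivity)
  refine (mul_le_mul_of_nonneg_right hcard h0).trans_eq ?_
  rw [div_eq_mul_inv]
  ring

theorem upper_bound_expectation (n k : ℕ) (hk : 1 ≤ k) (hkn : 2 * k ≤ n) :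
    iProp n k ≤
      2 * Real.exp 1 * k *
        ∑' c : Fin k → ℕ,
          ((Lset k c).card : ℝ) / ((max (mfun k c) (k - Sfun k c) : ℕ) : ℝ) ^ 2 * pmfVec k c := by
  refine (iProp_le_sum_cycleWeight n k).trans ((sum_cycleWeight_le_sum_sigma hk hkn).trans ?_)
  refine (Finset.sum_le_sum fun v _ => sum_pivotLengths_le v).trans ?_
  refine le_trans ?_ (mul_le_mul_of_nonneg_left
    ((summable_card_Lset_div_mul_pmfVec k).sum_le_tsum (boundedVecs n k)
      fun v _ => mul_nonneg (by positivity) (pmfVec_nonneg k v)) (by positivity))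
  rw [Finset.mul_sum]
  refine Finset.sum_le_sum fun v _ => ?_
  refine (mul_le_mul_of_nonneg_left (cycleWeight_vecMultiset_le hk v) (by positivity)).trans_eq ?_
  ring
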